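/- Let (𝔤, J₁, J₂, J₃) be a 2-step nilpotent hypercomplex real Lie algebra and set 𝔥 = (𝔤¹ ∩ J₂𝔤¹) + (J₁𝔤¹ ∩ J₃𝔤¹). Then the Obata connection satisfies: (i) ∇_X Y ∈ 𝔤₁^ℍ = 𝔤¹ + J₁𝔤¹ + J₂𝔤¹ + J₃𝔤¹ for all X, Y ∈ 𝔤; and (ii) ∇_X Z ∈ 𝔥 for all X ∈ 𝔤 and all Z ∈ 𝔤₁^ℍ. -/

import Mathlib

noncomputable section

/-- The commutator ideal `𝔤¹ = [𝔤,𝔤]` of a real Lie algebra, as a submodule: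
the span of all brackets. -/
def commIdeal (L : Type*) [LieRing L] [LieAlgebra ℝ L] : Submodule ℝ L :=
  Submodule.span ℝ {z : L | ∃ x y : L, ⁅x, y⁆ = z}

/-- The center `𝔷` of a real Lie algebra, as a submodule. -/
def centerSub (L : Type*) [LieRing L] [LieAlgebra ℝ L] : Submodule ℝ L where
  carrier := {z : L | ∀ x : L, ⁅z, x⁆ = 0}
  add_mem' := by
    intro a b ha hb x
    rw [add_lie, ha x, hb x, add_zero]
  zero_mem' := fun x => zero_lie x
  smul_mem' := by
    intro c a ha x
    rw [smul_lie, ha x, smul_zero]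

/-- The Nijenhuis tensor of an endomorphism `J` of a Lie algebra. -/
def nijenhuis {L : Type*} [LieRing L] [LieAlgebra ℝ L] (J : Module.End ℝ L) (X Y : L) : L :=
  ⁅X, Y⁆ + J (⁅J X, Y⁆ + ⁅X, J Y⁆) - ⁅J X, J Y⁆

/-- A complex structure on a real Lie algebra: `J² = -id` and `N_J ≡ 0`. -/
structure IsComplexStructure {L : Type*} [LieRing L] [LieAlgebra ℝ L]
    (J : Module.End ℝ L) : Prop where
  sq : ∀ X : L, J (J X) = -X
  integrable : ∀ X Y : L, nijenhuis J X Y = 0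

/-- A hypercomplex structure `(J₁,J₂,J₃)` on a real Lie algebra. -/
structure IsHypercomplex {L : Type*} [LieRing L] [LieAlgebra ℝ L]
    (J1 J2 J3 : Module.End ℝ L) : Prop where
  c1 : IsComplexStructure J1
  c2 : IsComplexStructure J2
  c3 : IsComplexStructure J3
  q12 : ∀ X : L, J1 (J2 X) = J3 X
  q21 : ∀ X : L, J2 (J1 X) = -J3 X

/-- The Obata connection `∇_X Y` of a hypercomplex Lie algebra. -/
def obata {L : Type*} [LieRing L] [LieAlgebra ℝ L] (J1 J2 J3 : Module.End ℝ L)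
    (X Y : L) : L :=
  (1/2 : ℝ) • (⁅X, Y⁆ + J1 ⁅J1 X, Y⁆ - J2 ⁅X, J2 Y⁆ + J3 ⁅J1 X, J2 Y⁆)

/-- The curvature tensor `R(X,Y)Z` of the Obata connection. -/
def obataCurv {L : Type*} [LieRing L] [LieAlgebra ℝ L] (J1 J2 J3 : Module.End ℝ L)
    (X Y Z : L) : L :=
  obata J1 J2 J3 X (obata J1 J2 J3 Y Z) - obata J1 J2 J3 Y (obata J1 J2 J3 X Z)
    - obata J1 J2 J3 ⁅X, Y⁆ Z

/-- The subspace `𝔥 = (𝔤¹ ∩ J₂𝔤¹) + (J₁𝔤¹ ∩ J₃𝔤¹)`. -/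
def hSub {L : Type*} [LieRing L] [LieAlgebra ℝ L] (J1 J2 J3 : Module.End ℝ L) :
    Submodule ℝ L :=
  (commIdeal L ⊓ (commIdeal L).map J2) ⊔ ((commIdeal L).map J1 ⊓ (commIdeal L).map J3)

section ObataConnection

variable {L : Type*} [LieRing L] [LieAlgebra ℝ L]

lemma lie_mem_commIdeal (X Y : L) : ⁅X, Y⁆ ∈ commIdeal L :=
  Submodule.subset_span ⟨X, Y, rfl⟩

/-- For `Z` commuting with everything, integrability of `J` gives `[JX, JZ] = J[X, JZ]`. -/
lemma IsComplexStructure.apply_lie_of_mem_center {J : Module.End ℝ L}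
    (hJ : IsComplexStructure J) {Z : L} (hZ : Z ∈ centerSub L) (X : L) :
    ⁅J X, J Z⁆ = J ⁅X, J Z⁆ := by
  have hcomm : ∀ Y : L, ⁅Y, Z⁆ = 0 := fun Y => by
    rw [← lie_skew, show ⁅Z, Y⁆ = 0 from hZ Y, neg_zero]
  have h := hJ.integrable X Z
  simp only [nijenhuis, hcomm, zero_add] at h
  exact (sub_eq_zero.mp h).symm

namespace IsHypercomplex

variable {J1 J2 J3 : Module.End ℝ L}

lemma apply_J1_J3 (hH : IsHypercomplex J1 J2 J3) (X : L) : J1 (J3 X) = -J2 X := by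
  rw [← hH.q12, hH.c1.sq]

lemma apply_J2_J3 (hH : IsHypercomplex J1 J2 J3) (X : L) : J2 (J3 X) = J1 X := by
  rw [← hH.q12, hH.q21, ← hH.q12, hH.c2.sq, map_neg, neg_neg]

lemma apply_J3_J1 (hH : IsHypercomplex J1 J2 J3) (X : L) : J3 (J1 X) = J2 X := by
  rw [← hH.q12, hH.q21, map_neg, hH.apply_J1_J3, neg_neg]

/-- The Obata connection preserves `J₂`. -/
lemma obata_J2 (hH : IsHypercomplex J1 J2 J3) (X Y : L) :
    obata J1 J2 J3 X (J2 Y) = J2 (obata J1 J2 J3 X Y) := by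
  simp only [obata, map_smul, map_add, map_sub, hH.c2.sq, hH.q21, hH.apply_J2_J3, lie_neg,
    map_neg]
  congr 1
  abel

/-- The Obata connection preserves `J₁`. -/
lemma obata_J1 (hH : IsHypercomplex J1 J2 J3) (X Y : L) :
    obata J1 J2 J3 X (J1 Y) = J1 (obata J1 J2 J3 X Y) := by
  have h1 := congrArg J1 (hH.c1.integrable X Y)
  have h2 := congrArg J3 (hH.c1.integrable X (J2 Y))
  simp only [nijenhuis, map_add, map_sub, map_zero, hH.c1.sq, hH.q12, hH.apply_J3_J1] at h1 h2
  simp only [obata, map_smul, map_add, map_sub, hH.c1.sq, hH.q12, hH.q21, hH.apply_J1_J3,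
    lie_neg, map_neg]
  congr 1
  rw [← sub_eq_zero, ← sub_eq_zero.mpr (h2.trans h1.symm)]
  abel

/-- The Obata connection preserves `J₃`. -/
lemma obata_J3 (hH : IsHypercomplex J1 J2 J3) (X Y : L) :
    obata J1 J2 J3 X (J3 Y) = J3 (obata J1 J2 J3 X Y) := by
  rw [← hH.q12, hH.obata_J1, hH.obata_J2, hH.q12]

lemma J1_mem_hSub (hH : IsHypercomplex J1 J2 J3) {W : L} (hW : W ∈ hSub J1 J2 J3) :
    J1 W ∈ hSub J1 J2 J3 := by
  obtain ⟨_, ⟨ha, b, hb, rfl⟩, _, ⟨⟨c, hc, rfl⟩, d, hd, hdc⟩, rfl⟩ := Submodule.mem_sup.mp hW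
  rw [map_add, add_comm]
  refine Submodule.add_mem_sup ⟨?_, ?_⟩ ⟨⟨_, ha, rfl⟩, b, hb, (hH.q12 b).symm⟩
  · rw [hH.c1.sq]
    exact neg_mem hc
  · rw [← hdc, hH.apply_J1_J3]
    exact neg_mem ⟨d, hd, rfl⟩

lemma J2_mem_hSub (hH : IsHypercomplex J1 J2 J3) {W : L} (hW : W ∈ hSub J1 J2 J3) :
    J2 W ∈ hSub J1 J2 J3 := by
  obtain ⟨_, ⟨ha, b, hb, rfl⟩, _, ⟨⟨c, hc, rfl⟩, d, hd, hdc⟩, rfl⟩ := Submodule.mem_sup.mp hW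
  rw [map_add]
  refine Submodule.add_mem_sup ⟨?_, ⟨_, ha, rfl⟩⟩ ⟨?_, ?_⟩
  · rw [hH.c2.sq]
    exact neg_mem hb
  · rw [← hdc, hH.apply_J2_J3]
    exact ⟨d, hd, rfl⟩
  · rw [hH.q21]
    exact neg_mem ⟨c, hc, rfl⟩

lemma J3_mem_hSub (hH : IsHypercomplex J1 J2 J3) {W : L} (hW : W ∈ hSub J1 J2 J3) :
    J3 W ∈ hSub J1 J2 J3 := by
  rw [← hH.q12]
  exact hH.J1_mem_hSub (hH.J2_mem_hSub hW)

lemma obata_mem_hSub_of_mem_center (hH : IsHypercomplex J1 J2 J3) {Z : L}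
    (hZ : Z ∈ centerSub L) (X : L) : obata J1 J2 J3 X Z ∈ hSub J1 J2 J3 := by
  have hcomm : ∀ Y : L, ⁅Y, Z⁆ = 0 := fun Y => by
    rw [← lie_skew, show ⁅Z, Y⁆ = 0 from hZ Y, neg_zero]
  have hmem : ∀ Y : L, J2 ⁅Y, J2 Z⁆ ∈ commIdeal L ⊓ (commIdeal L).map J2 := fun Y =>
    ⟨hH.c2.apply_lie_of_mem_center hZ Y ▸ lie_mem_commIdeal _ _, _, lie_mem_commIdeal _ _, rfl⟩
  have hsub : ∀ Y : L, J2 ⁅Y, J2 Z⁆ ∈ hSub J1 J2 J3 := fun Y =>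
    Submodule.mem_sup_left (hmem Y)
  rw [obata, hcomm, hcomm, map_zero, zero_add, zero_sub, ← hH.q12]
  exact Submodule.smul_mem _ _ (add_mem (neg_mem (hsub X)) (hH.J1_mem_hSub (hsub (J1 X))))

end IsHypercomplex

lemma obata_add_right (J1 J2 J3 : Module.End ℝ L) (X Y Z : L) :
    obata J1 J2 J3 X (Y + Z) = obata J1 J2 J3 X Y + obata J1 J2 J3 X Z := by
  simp only [obata, map_add, lie_add, ← smul_add]
  congr 1
  abel

end ObataConnection

/-- In a 2-step nilpotent hypercomplex Lie algebra, the Obata connection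
satisfies: (i) `∇_X Y ∈ 𝔤₁^ℍ = 𝔤¹ + J₁𝔤¹ + J₂𝔤¹ + J₃𝔤¹` for all `X, Y`; and
(ii) `∇_X Z ∈ 𝔥 = (𝔤¹ ∩ J₂𝔤¹) + (J₁𝔤¹ ∩ J₃𝔤¹)` for all `X ∈ 𝔤` and `Z ∈ 𝔤₁^ℍ`. -/
theorem stmt_17 {L : Type*} [LieRing L] [LieAlgebra ℝ L] [FiniteDimensional ℝ L]
    (J1 J2 J3 : Module.End ℝ L) (hH : IsHypercomplex J1 J2 J3)
    (h2 : commIdeal L ≤ centerSub L) :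
    (∀ X Y : L, obata J1 J2 J3 X Y ∈
      commIdeal L ⊔ (commIdeal L).map J1 ⊔ (commIdeal L).map J2 ⊔ (commIdeal L).map J3) ∧
    (∀ X : L, ∀ Z ∈
      commIdeal L ⊔ (commIdeal L).map J1 ⊔ (commIdeal L).map J2 ⊔ (commIdeal L).map J3,
      obata J1 J2 J3 X Z ∈ hSub J1 J2 J3) := by
  refine ⟨fun X Y => ?_, fun X Z hZ => ?_⟩
  · rw [obata]
    have hm : ∀ (J : Module.End ℝ L) (A B : L), J ⁅A, B⁆ ∈ (commIdeal L).map J :=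
      fun J A B => ⟨_, lie_mem_commIdeal A B, rfl⟩
    refine Submodule.smul_mem _ _ (Submodule.add_mem_sup ?_ (hm _ _ _))
    rw [sub_eq_add_neg]
    exact Submodule.add_mem_sup (Submodule.add_mem_sup (lie_mem_commIdeal X Y) (hm _ _ _))
      (neg_mem (hm _ _ _))
  · have hc : ∀ W ∈ commIdeal L, obata J1 J2 J3 X W ∈ hSub J1 J2 J3 := fun W hW =>
      hH.obata_mem_hSub_of_mem_center (h2 hW) X
    obtain ⟨_, hZ', _, ⟨d, hd, rfl⟩, rfl⟩ := Submodule.mem_sup.mp hZ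
    obtain ⟨_, hZ'', _, ⟨c, hcm, rfl⟩, rfl⟩ := Submodule.mem_sup.mp hZ'
    obtain ⟨a, ha, _, ⟨b, hb, rfl⟩, rfl⟩ := Submodule.mem_sup.mp hZ''
    rw [obata_add_right, obata_add_right, obata_add_right, hH.obata_J1, hH.obata_J2,
      hH.obata_J3]
    exact add_mem (add_mem (add_mem (hc a ha) (hH.J1_mem_hSub (hc b hb)))
      (hH.J2_mem_hSub (hc c hcm))) (hH.J3_mem_hSub (hc d hd))
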